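/- Euler–Lagrange divergence identity for the source sector: for the Banerjee source operator E_J^ν = -J^ν - θ^{να} J^β F_{αβ} - θ^{αβ}(∂_α J^ν) A_β - θ^{αβ} J^ν ∂_α A_β + (1/2) θ^{νβ} (∂_μ J^μ) A_β on ℝ⁴ with θ^{0i}=0, its four-divergence equals -∂_μ J^μ + θ^{li}(∂_i J^0) ∂_l A_0 + θ^{li} ∂_i(J^k ∂_l A_k) - (1/2) θ^{il} ∂_i(A_l ∂_μ J^μ), where spatial indices run over 1..3. -/

import Mathlib

/-- Partial derivative in the `μ`-th coordinate direction on `ℝ⁴`. -/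
noncomputable def pd {n : ℕ} (i : Fin n) (f : (Fin n → ℝ) → ℝ) (x : Fin n → ℝ) : ℝ :=
  fderiv ℝ f x (Pi.single i 1)

section PartialDerivative

variable {n : ℕ} {f g : (Fin n → ℝ) → ℝ} {x : Fin n → ℝ}

theorem pd_add (i : Fin n) (hf : DifferentiableAt ℝ f x) (hg : DifferentiableAt ℝ g x) :
    pd i (fun y => f y + g y) x = pd i f x + pd i g x := by
  simp [pd, fderiv_fun_add hf hg]

theorem pd_sub (i : Fin n) (hf : DifferentiableAt ℝ f x) (hg : DifferentiableAt ℝ g x) :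
    pd i (fun y => f y - g y) x = pd i f x - pd i g x := by
  simp [pd, fderiv_fun_sub hf hg]

theorem pd_neg (i : Fin n) : pd i (fun y => -f y) x = -pd i f x := by
  simp [pd, fderiv_fun_neg]

theorem pd_mul (i : Fin n) (hf : DifferentiableAt ℝ f x) (hg : DifferentiableAt ℝ g x) :
    pd i (fun y => f y * g y) x = pd i f x * g x + f x * pd i g x := by
  simp [pd, fderiv_fun_mul hf hg]
  ring

theorem pd_const_mul (i : Fin n) (c : ℝ) (hf : DifferentiableAt ℝ f x) :
    pd i (fun y => c * f y) x = c * pd i f x := by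
  simp [pd, fderiv_const_mul hf]

theorem pd_sum {ι : Type*} (i : Fin n) (s : Finset ι) {h : ι → (Fin n → ℝ) → ℝ}
    (hh : ∀ k ∈ s, DifferentiableAt ℝ (h k) x) :
    pd i (fun y => ∑ k ∈ s, h k y) x = ∑ k ∈ s, pd i (h k) x := by
  simp [pd, fderiv_fun_sum hh]

theorem differentiable_pd (hf : ContDiff ℝ 2 f) (i : Fin n) : Differentiable ℝ (pd i f) := by
  have h : ContDiff ℝ 1 (fderiv ℝ f) := hf.fderiv_right (by norm_num)
  exact (h.clm_apply contDiff_const).differentiable (by norm_num)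

theorem pd_pd_comm (hf : ContDiff ℝ 2 f) (i j : Fin n) (x : Fin n → ℝ) :
    pd i (pd j f) x = pd j (pd i f) x := by
  have h : Differentiable ℝ (fderiv ℝ f) :=
    (hf.fderiv_right (m := 1) (by norm_num)).differentiable (by norm_num)
  have key (i j : Fin n) : pd i (pd j f) x
      = fderiv ℝ (fderiv ℝ f) x (Pi.single i 1) (Pi.single j 1) := by
    change fderiv ℝ (fun y => fderiv ℝ f y (Pi.single j 1)) x (Pi.single i 1) = _
    rw [fderiv_clm_apply (h x) (differentiableAt_const _)]
    simp
  rw [key, key]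
  exact (hf.contDiffAt.isSymmSndFDerivAt (by simp)) _ _

end PartialDerivative

/-- The algebraic core of the divergence identity: `J`, `A`, `a`, `j`, `b`, `c` are the values at a
point of the fields, of their first derivatives `a μ ν = ∂_μ A_ν`, `j μ ν = ∂_μ J^ν`, and of their
second derivatives `b κ μ ν = ∂_κ ∂_μ A_ν`, `c κ μ ν = ∂_κ ∂_μ J^ν`. -/
theorem divergence_sum_identity
    {θ : Fin 4 → Fin 4 → ℝ} (hθ : ∀ μ ν, θ μ ν = -θ ν μ)
    (A J : Fin 4 → ℝ) (a j : Fin 4 → Fin 4 → ℝ) {b c : Fin 4 → Fin 4 → Fin 4 → ℝ}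
    (hb : ∀ κ μ ν, b κ μ ν = b μ κ ν) (hc : ∀ κ μ ν, c κ μ ν = c μ κ ν) :
    ∑ ν, (-j ν ν
        - (∑ α, ∑ β, θ ν α * (j ν β * (a α β - a β α) + J β * (b ν α β - b ν β α)))
        - (∑ α, ∑ β, θ α β * (c ν α ν * A β + j α ν * a ν β))
        - (∑ α, ∑ β, θ α β * (j ν ν * a α β + J ν * b ν α β))
        + (1 / 2 : ℝ) * ∑ β, θ ν β * ((∑ μ, c ν μ μ) * A β + (∑ μ, j μ μ) * a ν β)) =
      -(∑ μ, j μ μ) + (∑ l, ∑ i, θ l i * j i 0 * a l 0)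
      + (∑ l, ∑ i, θ l i * ∑ k ∈ ({1, 2, 3} : Finset (Fin 4)), (j i k * a l k + J k * b i l k))
      - (1 / 2 : ℝ) * ∑ i, ∑ l, θ i l * (a i l * (∑ μ, j μ μ) + A l * ∑ μ, c i μ μ) := by
  have hd (μ : Fin 4) : θ μ μ = 0 := by linarith [hθ μ μ]
  have hs (h : Fin 4 → ℝ) :
      ∑ k ∈ ({1, 2, 3} : Finset (Fin 4)), h k = h 1 + h 2 + h 3 := by
    simp [add_assoc]
  simp only [hs, Fin.sum_univ_four, hd, hθ 1 0, hθ 2 0, hθ 3 0, hθ 2 1, hθ 3 1, hθ 3 2,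
    hb 1 0, hb 2 0, hb 3 0, hb 2 1, hb 3 1, hb 3 2,
    hc 1 0, hc 2 0, hc 3 0, hc 2 1, hc 3 1, hc 3 2]
  ring

/-- Divergence identity for the Banerjee source sector: the four-divergence of
`E_J^ν = -J^ν - θ^{να} J^β F_{αβ} - θ^{αβ}(∂_α J^ν) A_β - θ^{αβ} J^ν ∂_α A_β
+ (1/2) θ^{νβ} (∂_μ J^μ) A_β` equals
`-∂_μ J^μ + θ^{li}(∂_i J⁰) ∂_l A₀ + θ^{li} ∂_i(J^k ∂_l A_k)
- (1/2) θ^{il} ∂_i(A_l ∂_μ J^μ)`, with `θ` antisymmetric and `θ^{0i} = 0`. -/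
theorem source_divergence_identity
    (θ : Fin 4 → Fin 4 → ℝ) (hθ : ∀ μ ν, θ μ ν = -θ ν μ)
    (hθ0 : ∀ μ : Fin 4, θ 0 μ = 0)
    (A J : (Fin 4 → ℝ) → Fin 4 → ℝ)
    (hA : ContDiff ℝ 2 A) (hJ : ContDiff ℝ 2 J)
    (F : (Fin 4 → ℝ) → Fin 4 → Fin 4 → ℝ)
    (hF : ∀ x μ ν, F x μ ν = pd μ (fun y => A y ν) x - pd ν (fun y => A y μ) x)
    (EJ : Fin 4 → (Fin 4 → ℝ) → ℝ)
    (hEJ : ∀ (ν : Fin 4) (x : Fin 4 → ℝ), EJ ν x =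
      -J x ν
      - (∑ α : Fin 4, ∑ β : Fin 4, θ ν α * J x β * F x α β)
      - (∑ α : Fin 4, ∑ β : Fin 4, θ α β * pd α (fun y => J y ν) x * A x β)
      - (∑ α : Fin 4, ∑ β : Fin 4, θ α β * J x ν * pd α (fun y => A y β) x)
      + (1 / 2 : ℝ) * ∑ β : Fin 4,
          θ ν β * (∑ μ : Fin 4, pd μ (fun y => J y μ) x) * A x β) :
    ∀ x : Fin 4 → ℝ,
      ∑ ν : Fin 4, pd ν (EJ ν) x =
        -(∑ μ : Fin 4, pd μ (fun y => J y μ) x)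
        + (∑ l : Fin 4, ∑ i : Fin 4,
            θ l i * pd i (fun y => J y 0) x * pd l (fun y => A y 0) x)
        + (∑ l : Fin 4, ∑ i : Fin 4, θ l i *
            pd i (fun y => ∑ k ∈ ({1, 2, 3} : Finset (Fin 4)),
              J y k * pd l (fun z => A z k) y) x)
        - (1 / 2 : ℝ) * ∑ i : Fin 4, ∑ l : Fin 4, θ i l *
            pd i (fun y => A y l * ∑ μ : Fin 4, pd μ (fun z => J z μ) y) x := by
  intro x
  have hA' (μ : Fin 4) : ContDiff ℝ 2 fun y => A y μ := contDiff_pi.1 hA μ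
  have hJ' (μ : Fin 4) : ContDiff ℝ 2 fun y => J y μ := contDiff_pi.1 hJ μ
  have dA (μ : Fin 4) : Differentiable ℝ fun y => A y μ := (hA' μ).differentiable (by norm_num)
  have dJ (μ : Fin 4) : Differentiable ℝ fun y => J y μ := (hJ' μ).differentiable (by norm_num)
  have dpA (i μ : Fin 4) : Differentiable ℝ (pd i fun z => A z μ) := differentiable_pd (hA' μ) i
  have dpJ (i μ : Fin 4) : Differentiable ℝ (pd i fun z => J z μ) := differentiable_pd (hJ' μ) i
  have hE (ν : Fin 4) : EJ ν = _ := funext (hEJ ν)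
  simp only [hE, hF, mul_assoc]
  simp (disch := first | fun_prop | (intros; fun_prop)) only
    [pd_add, pd_sub, pd_neg, pd_const_mul, pd_sum, pd_mul]
  simpa only [mul_assoc] using divergence_sum_identity hθ (A x) (J x)
    (fun μ ν => pd μ (fun y => A y ν) x) (fun μ ν => pd μ (fun y => J y ν) x)
    (fun κ μ ν => pd_pd_comm (hA' ν) κ μ x) (fun κ μ ν => pd_pd_comm (hJ' ν) κ μ x)
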